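/- Let S be a finite 2-group containing an elementary abelian subgroup of rank 3, and let X ⊴ S be a normal elementary abelian subgroup of rank at least 2. Then the centralizer C_S(X) contains an elementary abelian subgroup of rank 3. -/

import Mathlib

/-- A nontrivial normal subgroup of a finite `p`-group contains a nontrivial central element. -/
theorem IsPGroup.exists_ne_one_mem_center_of_normal {G : Type*} [Group G] [Finite G] {p : ℕ}
    [Fact p.Prime] (hG : IsPGroup p G) (N : Subgroup G) [N.Normal] (hN : N ≠ ⊥) :
    ∃ z ∈ N, z ≠ 1 ∧ z ∈ Subgroup.center G := by
  have hC : IsPGroup p (ConjAct G) := hG.of_equiv ConjAct.toConjAct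
  have hdvd : p ∣ Nat.card N := by
    obtain ⟨n, hn⟩ := IsPGroup.iff_card.mp (hG.to_subgroup N)
    rcases n with _ | n
    · exact absurd (N.eq_bot_of_card_eq (by simpa using hn)) hN
    · exact hn ▸ dvd_pow_self p n.succ_ne_zero
  have h1 : (1 : N) ∈ MulAction.fixedPoints (ConjAct G) N := fun g => smul_one g
  obtain ⟨z, hz, hz1⟩ := hC.exists_fixed_point_of_prime_dvd_card_of_fixed_point N hdvd h1
  refine ⟨z, z.2, fun h => hz1 (Subtype.ext h.symm), Subgroup.mem_center_iff.mpr fun g => ?_⟩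
  have h := congrArg Subtype.val (hz (ConjAct.toConjAct g))
  rw [ConjAct.Subgroup.val_conj_smul, ConjAct.toConjAct_smul] at h
  exact mul_inv_eq_iff_eq_mul.mp h

/-- Elements of a subgroup of exponent two commute. -/
theorem Subgroup.le_centralizer_of_sq_eq_one {G : Type*} [Group G] (H : Subgroup G)
    (hH : ∀ x ∈ H, x ^ 2 = 1) : H ≤ Subgroup.centralizer (H : Set G) := by
  have inv_eq {x : G} (hx : x ∈ H) : x⁻¹ = x :=
    inv_eq_of_mul_eq_one_left (by rw [← sq, hH x hx])
  intro x hx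
  refine Subgroup.mem_centralizer_iff.mpr fun y hy => ?_
  have h := inv_eq (H.mul_mem hy hx)
  rw [mul_inv_rev, inv_eq hx, inv_eq hy] at h
  exact h.symm

/-- In a finite `2`-group, the centralizer of a normal Klein four-subgroup meets any subgroup not
contained in it in a subgroup of index two. -/
theorem Subgroup.relIndex_centralizer_eq_two {G : Type*} [Group G] [Finite G]
    (hG : IsPGroup 2 G) (X : Subgroup G) [X.Normal] (hX : Nat.card X = 4)
    (hXe : ∀ x ∈ X, x ^ 2 = 1) (A : Subgroup G)
    (hA : ¬ A ≤ Subgroup.centralizer (X : Set G)) :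
    (Subgroup.centralizer (X : Set G)).relIndex A = 2 := by
  obtain ⟨z, hzX, hz1, hz⟩ := hG.exists_ne_one_mem_center_of_normal X (by
    rintro rfl
    simp at hX)
  have hzc (g : G) : g * z = z * g := Subgroup.mem_center_iff.mp hz g
  have hzz : z * z = 1 := by rw [← sq, hXe z hzX]
  obtain ⟨x, hxX, hx⟩ : ∃ x ∈ (X : Set G), x ∉ ({1, z} : Set G) := by
    refine Set.exists_mem_notMem_of_ncard_lt_ncard ?_
    have : (X : Set G).ncard = 4 := hX
    rw [this, Set.ncard_pair hz1.symm]
    norm_num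
  simp only [Set.mem_insert_iff, Set.mem_singleton_iff, not_or] at hx
  have hXset : ({1, z, x, x * z} : Set G) = X := by
    refine Set.eq_of_subset_of_ncard_le ?_ ?_
    · rintro y (rfl | rfl | rfl | rfl)
      exacts [X.one_mem, hzX, hxX, X.mul_mem hxX hzX]
    · have : (X : Set G).ncard = 4 := hX
      rw [this, Set.ncard_insert_of_notMem, Set.ncard_insert_of_notMem, Set.ncard_pair]
      · simpa using hz1
      · simp only [Set.mem_insert_iff, Set.mem_singleton_iff, not_or]
        exact ⟨fun h => hx.2 h.symm, fun h => hx.1 (by simpa using h.symm)⟩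
      · simp only [Set.mem_insert_iff, Set.mem_singleton_iff, not_or]
        exact ⟨hz1.symm, fun h => hx.1 h.symm, fun h =>
          hx.2 (mul_right_cancel (b := z) (by rw [← h, hzz]))⟩
  have mem_iff (g : G) : g ∈ Subgroup.centralizer (X : Set G) ↔ g * x = x * g := by
    rw [Subgroup.mem_centralizer_iff]
    refine ⟨fun h => (h x hxX).symm, fun h y hy => ?_⟩
    rw [← hXset] at hy
    rcases hy with rfl | rfl | rfl | rfl
    · simp
    · exact (hzc g).symm
    · exact h.symm
    · rw [← mul_assoc, h, mul_assoc, mul_assoc, hzc]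
  have of_notMem {g : G} (hg : g ∉ Subgroup.centralizer (X : Set G)) :
      g * x = x * z * g := by
    rw [mem_iff] at hg
    have h : g * x * g⁻¹ ∈ (X : Set G) := ‹X.Normal›.conj_mem x hxX g
    rw [← hXset] at h
    rcases h with h | h | h | h
    · exact absurd (conj_eq_one_iff.mp h) hx.1
    · refine absurd (mul_left_cancel (a := g) ?_) hx.2
      rw [mul_inv_eq_iff_eq_mul.mp h, hzc]
    · exact absurd (mul_inv_eq_iff_eq_mul.mp h) hg
    · exact mul_inv_eq_iff_eq_mul.mp h
  obtain ⟨a, haA, ha⟩ := SetLike.not_le_iff_exists.mp hA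
  rw [Subgroup.relIndex, Subgroup.index_eq_two_iff]
  refine ⟨⟨a, haA⟩, fun b => ?_⟩
  simp only [Subgroup.mem_subgroupOf, Subgroup.coe_mul]
  by_cases hb : (b : G) ∈ Subgroup.centralizer (X : Set G)
  · exact Or.inr ⟨hb, fun h => ha ((Subgroup.mul_mem_cancel_left _ hb).mp h)⟩
  · refine Or.inl ⟨(mem_iff _).mpr ?_, hb⟩
    calc (b : G) * a * x = b * x * (z * a) := by rw [mul_assoc, of_notMem ha]; simp [mul_assoc]
      _ = x * (z * (b * z)) * a := by rw [of_notMem hb]; simp [mul_assoc]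
      _ = x * (b * a) := by rw [hzc, ← mul_assoc z z, hzz, one_mul, mul_assoc]

theorem centralizer_of_normal_four_subgroup_has_rank_three {S : Type*} [Group S] [Finite S]
    (h2 : IsPGroup 2 S)
    (A : Subgroup S) (hA8 : Nat.card A = 8) (hAe : ∀ x ∈ A, x ^ 2 = 1)
    (X : Subgroup S) [X.Normal] (hX4 : 4 ≤ Nat.card X) (hXe : ∀ x ∈ X, x ^ 2 = 1) :
    ∃ B : Subgroup S, B ≤ Subgroup.centralizer (X : Set S) ∧
      Nat.card B = 8 ∧ ∀ x ∈ B, x ^ 2 = 1 := by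
  by_cases hA : A ≤ Subgroup.centralizer (X : Set S)
  · exact ⟨A, hA, hA8, hAe⟩
  set C := Subgroup.centralizer (X : Set S)
  set E := C ⊓ A ⊔ X
  have hEC : E ≤ C := sup_le inf_le_left (X.le_centralizer_of_sq_eq_one hXe)
  have hEe : ∀ x ∈ E, x ^ 2 = 1 := by
    intro e he
    obtain ⟨a, ha, x, hx, rfl⟩ := Subgroup.mem_sup_of_normal_right.mp he
    have hc : Commute a x := (Subgroup.mem_centralizer_iff.mp ha.1 x hx).symm
    rw [hc.mul_pow, hAe a ha.2, hXe x hx, one_mul]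
  by_cases hE : 2 ^ 3 ≤ Nat.card E
  · obtain ⟨B, hBE, hB⟩ :=
      Sylow.exists_subgroup_le_card_pow_prime_of_le_card Nat.prime_two h2 hE
    exact ⟨B, hBE.trans hEC, hB, fun x hx => hEe x (hBE hx)⟩
  have hE4 : Nat.card E ≤ 4 := by
    obtain ⟨n, hn⟩ := IsPGroup.iff_card.mp (h2.to_subgroup E)
    rw [hn, not_le, Nat.pow_lt_pow_iff_right one_lt_two] at hE
    rw [hn]
    exact Nat.pow_le_pow_right two_pos (Nat.le_of_lt_succ hE)
  have hXE : X = E := Subgroup.eq_of_le_of_card_ge le_sup_right (hE4.trans hX4)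
  have hX : Nat.card X = 4 := le_antisymm (hXE ▸ hE4) hX4
  have hCA : Nat.card (C ⊓ A : Subgroup S) = 4 := by
    have h := Subgroup.relIndex_mul_relIndex ⊥ (C ⊓ A) A bot_le inf_le_right
    rw [Subgroup.relIndex_bot_left, Subgroup.relIndex_bot_left, Subgroup.inf_relIndex_right,
      X.relIndex_centralizer_eq_two h2 hX hXe A hA, hA8] at h
    lia
  have hCX : C ⊓ A = X :=
    Subgroup.eq_of_le_of_card_ge (le_sup_left.trans hXE.ge) (by rw [hX, hCA])
  have hXA : X ≤ A := hCX ▸ inf_le_right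
  exact absurd ((A.le_centralizer_of_sq_eq_one hAe).trans (Subgroup.centralizer_le hXA)) hA
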